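/- (Closed-form quantification of the non-deterministic EOB, determinant form) Let 1 ≤ p ≤ T, let σ_z > 0 and σ_ε > 0, and let Σ be a real symmetric positive definite T×T matrix such that Σ_{tt} = σ_z² for all 0 ≤ t ≤ T−1 and s_t(Σ) = σ_ε² for all p ≤ t ≤ T−1. Then −½ log det R(Σ) = (T/2) · log(σ_z²/σ_ε²) − ½ log( det R(Σ^{(p)}) · (σ_z²/σ_ε²)^p ), and equivalently −½ log det R(Σ) = ((T−p)/2) · log(σ_z²/σ_ε²) − ½ log det R(Σ^{(p)}). -/

import Mathlib

open Matrix

/-- The correlation matrix: `R(Σ)_{ij} = Σ_{ij} / √(Σ_{ii} Σ_{jj})`. -/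
noncomputable def corrMat {T : ℕ} (S : Matrix (Fin T) (Fin T) ℝ) :
    Matrix (Fin T) (Fin T) ℝ :=
  fun i j => S i j / Real.sqrt (S i i * S j j)

/-- The `k×k` leading principal submatrix of a `T×T` matrix (0-based indices). -/
def lead {T : ℕ} (S : Matrix (Fin T) (Fin T) ℝ) (k : ℕ) (hk : k ≤ T) :
    Matrix (Fin k) (Fin k) ℝ :=
  S.submatrix (Fin.castLE hk) (Fin.castLE hk)

/-- The innovation variances: `s_0(Σ) = Σ_{00}` and, for `t ≥ 1`,
`s_t(Σ) = Σ_{tt} − b_tᵀ (Σ^{(t)})⁻¹ b_t` with `b_t = (Σ_{it})_{i<t}`. -/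
noncomputable def innov {T : ℕ} (S : Matrix (Fin T) (Fin T) ℝ) (t : Fin T) : ℝ :=
  S t t -
    (fun i : Fin t.val => S (Fin.castLE t.isLt.le i) t) ⬝ᵥ
      ((lead S t.val t.isLt.le)⁻¹ *ᵥ fun i : Fin t.val => S (Fin.castLE t.isLt.le i) t)

lemma lead_posDef {T : ℕ} {S : Matrix (Fin T) (Fin T) ℝ} (hS : S.PosDef) (k : ℕ) (hk : k ≤ T) :
    (lead S k hk).PosDef :=
  hS.submatrix (Fin.castLE_injective hk)

lemma det_lead_succ {T : ℕ} {S : Matrix (Fin T) (Fin T) ℝ} (hS : S.PosDef) (t : Fin T) :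
    (lead S (t.val + 1) t.isLt).det = (lead S t.val t.isLt.le).det * innov S t := by
  have hA := lead_posDef hS t.val t.isLt.le
  have hu : IsUnit (lead S t.val t.isLt.le) := hA.isUnit
  let b : Matrix (Fin t.val) (Fin 1) ℝ :=
    Matrix.of fun i _ => S (Fin.castLE t.isLt.le i) t
  have hblk : (lead S (t.val + 1) t.isLt).submatrix finSumFinEquiv finSumFinEquiv
      = fromBlocks (lead S t.val t.isLt.le) b bᵀ (Matrix.of fun _ _ => S t t) := by
    have h1 : ∀ i : Fin t.val, Fin.castLE t.isLt (finSumFinEquiv (Sum.inl i : Fin t.val ⊕ Fin 1))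
        = Fin.castLE t.isLt.le i := by
      intro i; ext; simp
    have h2 : ∀ i : Fin 1, Fin.castLE t.isLt (finSumFinEquiv (Sum.inr i : Fin t.val ⊕ Fin 1))
        = t := by
      intro i; ext; simp
    ext i j
    rcases i with i | i <;> rcases j with j | j
    · simp only [lead, submatrix_apply, h1, fromBlocks_apply₁₁]
    · simp only [lead, submatrix_apply, h1, h2, fromBlocks_apply₁₂, b, of_apply]
    · simp only [lead, submatrix_apply, h1, h2, fromBlocks_apply₂₁, b, transpose_apply, of_apply]
      simpa using hS.1.apply (Fin.castLE t.isLt.le j) t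
    · simp only [lead, submatrix_apply, h2, fromBlocks_apply₂₂, of_apply]
  let _ := hu.invertible
  rw [← det_submatrix_equiv_self finSumFinEquiv, hblk, det_fromBlocks₁₁]
  congr 1
  rw [det_fin_one, invOf_eq_nonsing_inv, Matrix.mul_assoc]
  rfl

lemma det_lead_add {T p : ℕ} {S : Matrix (Fin T) (Fin T) ℝ} (hS : S.PosDef) (e : ℝ)
    (hpT : p ≤ T) (hinn : ∀ t : Fin T, p ≤ t.val → innov S t = e) (k : ℕ) :
    ∀ hk : p + k ≤ T, (lead S (p + k) hk).det = (lead S p hpT).det * e ^ k := by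
  induction k with
  | zero => intro hk; simp
  | succ k ih =>
    intro hk
    have h := det_lead_succ hS ⟨p + k, hk⟩
    rw [hinn _ (Nat.le_add_right p k)] at h
    rw [pow_succ, ← mul_assoc, ← ih (by omega)]
    exact h

lemma det_corrMat {n : ℕ} (M : Matrix (Fin n) (Fin n) ℝ) (a : ℝ) (ha : 0 < a)
    (h : ∀ t, M t t = a) : (corrMat M).det = M.det / a ^ n := by
  have : corrMat M = a⁻¹ • M := by
    ext i j
    simp only [corrMat, h, Real.sqrt_mul_self ha.le, Matrix.smul_apply, smul_eq_mul]
    rw [div_eq_inv_mul]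
  rw [this, det_smul, Fintype.card_fin, inv_pow, div_eq_inv_mul]

/-- Closed-form quantification of the non-deterministic EOB (determinant form):
`−½ log det R(Σ) = (T/2) log(SSNR) + c` with `c = −½ log(det R(Σ^{(p)}) · SSNR^p)`,
and equivalently `−½ log det R(Σ) = ((T−p)/2) log(SSNR) − ½ log det R(Σ^{(p)})`,
where `SSNR = σ_z²/σ_ε²`. -/
theorem EOB_closed_form {T p : ℕ} (hp : 1 ≤ p) (hpT : p ≤ T)
    (σz σε : ℝ) (hz : 0 < σz) (hε : 0 < σε)
    (S : Matrix (Fin T) (Fin T) ℝ) (hS : S.PosDef)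
    (hdiag : ∀ t : Fin T, S t t = σz ^ 2)
    (hinn : ∀ t : Fin T, p ≤ t.val → innov S t = σε ^ 2) :
    -(1 / 2 : ℝ) * Real.log (corrMat S).det
      = (T : ℝ) / 2 * Real.log (σz ^ 2 / σε ^ 2)
        - 1 / 2 * Real.log ((corrMat (lead S p hpT)).det * (σz ^ 2 / σε ^ 2) ^ p) ∧
    -(1 / 2 : ℝ) * Real.log (corrMat S).det
      = ((T : ℝ) - p) / 2 * Real.log (σz ^ 2 / σε ^ 2)
        - 1 / 2 * Real.log (corrMat (lead S p hpT)).det := by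
  have hz2 : 0 < σz ^ 2 := by positivity
  have he2 : 0 < σε ^ 2 := by positivity
  have hD := (lead_posDef hS p hpT).det_pos
  obtain ⟨k, rfl⟩ := Nat.exists_eq_add_of_le hpT
  have hk := det_lead_add hS (σε ^ 2) hpT hinn k le_rfl
  have hl : lead S (p + k) le_rfl = S := rfl
  rw [hl] at hk
  rw [det_corrMat S _ hz2 hdiag, det_corrMat (lead S p hpT) _ hz2 (fun t => hdiag _), hk]
  generalize (lead S p hpT).det = D at *
  generalize σz ^ 2 = a at *
  generalize σε ^ 2 = e at *
  have := hD.ne'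
  have := hz2.ne'
  have := he2.ne'
  have h1 : Real.log (D * e ^ k / a ^ (p + k))
      = Real.log D + k * Real.log e - (p + k : ℕ) * Real.log a := by
    rw [Real.log_div (by positivity) (by positivity), Real.log_mul (by positivity) (by positivity),
      Real.log_pow, Real.log_pow]
  have h2 : Real.log (D / a ^ p) = Real.log D - p * Real.log a := by
    rw [Real.log_div (by positivity) (by positivity), Real.log_pow]
  have h3 : Real.log (a / e) = Real.log a - Real.log e :=
    Real.log_div (by positivity) (by positivity)
  have h4 : Real.log (D / a ^ p * (a / e) ^ p)
      = Real.log (D / a ^ p) + p * Real.log (a / e) := by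
    rw [Real.log_mul (by positivity) (by positivity), Real.log_pow]
  rw [h4, h1, h2, h3]
  push_cast
  constructor <;> ring
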